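/- Let n ≥ 1, let λ > 0, let L > 0, let 0 < α ≤ 1/L, and let f : ℝ^n → ℝ be continuously differentiable and L-smooth relative to h(x) = Σ_i x_i log x_i on S. Let x^0 ∈ S, and for each k ≥ 0 let x^{k+1} be a minimizer over the set {z ∈ S : supp(z) ⊆ supp(x^k)} of the function z ↦ ⟨∇f(x^k), z - x^k⟩ + (1/α) D(z, x^k) + λ‖z‖_0. Set F(x) = f(x) + λ‖x‖_0. Then the sequence (F(x^k))_{k≥0} is nonincreasing and converges to a finite limit, and there exist M ∈ ℕ and a set I ⊆ {1,...,n} such that supp(x^k) = I for all k ≥ M. -/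

import Mathlib

open Finset Filter Topology

noncomputable def klS (a b : ℝ) : ℝ := if a = 0 then b else a * Real.log (a / b) - a + b

noncomputable def kl {n : ℕ} (x y : Fin n → ℝ) : ℝ := ∑ i, klS (x i) (y i)

def probSimplex (n : ℕ) : Set (Fin n → ℝ) := {x | (∑ i, x i) = 1 ∧ ∀ i, 0 ≤ x i}

noncomputable def suppF {n : ℕ} (x : Fin n → ℝ) : Finset (Fin n) :=
  Finset.univ.filter (fun i => x i ≠ 0)

noncomputable def l0 {n : ℕ} (x : Fin n → ℝ) : ℕ := (suppF x).card

theorem klS_nonneg {a b : ℝ} (ha : 0 ≤ a) (hb : 0 ≤ b) (hab : a ≠ 0 → b ≠ 0) :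
    0 ≤ klS a b := by
  unfold klS
  split_ifs with h
  · exact hb
  · have ha' : 0 < a := lt_of_le_of_ne ha (Ne.symm h)
    have hb' : 0 < b := lt_of_le_of_ne hb (Ne.symm (hab h))
    have hlog := Real.one_sub_inv_le_log_of_pos (div_pos ha' hb')
    have hmul := mul_le_mul_of_nonneg_left hlog ha
    have hinv : a * (1 - (a / b)⁻¹) = a - b := by field_simp
    linarith

theorem klS_self (a : ℝ) : klS a a = 0 := by
  unfold klS
  split_ifs with h
  · exact h
  · simp [div_self h]

theorem kl_nonneg {n : ℕ} {x y : Fin n → ℝ} (hx : x ∈ probSimplex n)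
    (hy : y ∈ probSimplex n) (hxy : suppF x ⊆ suppF y) : 0 ≤ kl x y := by
  refine Finset.sum_nonneg fun i _ => klS_nonneg (hx.2 i) (hy.2 i) fun hi => ?_
  have hmem : i ∈ suppF y := hxy (by simp [suppF, hi])
  simpa [suppF] using hmem

theorem kl_self {n : ℕ} (x : Fin n → ℝ) : kl x x = 0 :=
  Finset.sum_eq_zero fun i _ => klS_self (x i)

theorem isCompact_probSimplex (n : ℕ) : IsCompact (probSimplex n) := by
  have h : probSimplex n = stdSimplex ℝ (Fin n) := by
    ext x
    exact and_comm
  exact h ▸ isCompact_stdSimplex ℝ (Fin n)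

theorem antitone_eventually_eq {β : Type*} [PartialOrder β] [WellFoundedLT β] {s : ℕ → β}
    (hs : Antitone s) : ∃ M, ∃ b, ∀ k, M ≤ k → s k = b := by
  obtain ⟨_, ⟨M, rfl⟩, hM⟩ :=
    (wellFounded_lt (α := β)).has_min (Set.range s) (Set.range_nonempty s)
  exact ⟨M, s M, fun k hk => (hs hk).eq_of_not_lt (hM _ ⟨k, rfl⟩)⟩

/-- the objective values are nonincreasing and converge, and the support
stabilizes after finitely many iterations. -/
theorem stmt_7 (n : ℕ) (hn : 1 ≤ n) (lam L α : ℝ) (hlam : 0 < lam) (hL : 0 < L)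
    (hα0 : 0 < α) (hαL : α ≤ 1 / L)
    (f : (Fin n → ℝ) → ℝ) (hf : ContDiff ℝ 1 f)
    (hsmooth : ∀ z ∈ probSimplex n, ∀ w ∈ probSimplex n, suppF z ⊆ suppF w →
      f z ≤ f w + fderiv ℝ f w (z - w) + L * kl z w)
    (X : ℕ → Fin n → ℝ) (hX0 : X 0 ∈ probSimplex n)
    (hXmem : ∀ k, X (k + 1) ∈ probSimplex n)
    (hXsupp : ∀ k, suppF (X (k + 1)) ⊆ suppF (X k))
    (hXmin : ∀ k, ∀ z ∈ probSimplex n, suppF z ⊆ suppF (X k) →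
      fderiv ℝ f (X k) (X (k + 1) - X k) + (1 / α) * kl (X (k + 1)) (X k)
          + lam * (l0 (X (k + 1)) : ℝ) ≤
      fderiv ℝ f (X k) (z - X k) + (1 / α) * kl z (X k) + lam * (l0 z : ℝ)) :
    (∀ k, f (X (k + 1)) + lam * (l0 (X (k + 1)) : ℝ) ≤ f (X k) + lam * (l0 (X k) : ℝ)) ∧
    (∃ c : ℝ, Tendsto (fun k => f (X k) + lam * (l0 (X k) : ℝ)) atTop (nhds c)) ∧
    (∃ M : ℕ, ∃ I : Finset (Fin n), ∀ k, M ≤ k → suppF (X k) = I) := by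
  have hmem : ∀ k, X k ∈ probSimplex n := fun k => by
    cases k with
    | zero => exact hX0
    | succ k => exact hXmem k
  have hdesc : ∀ k, f (X (k + 1)) + lam * (l0 (X (k + 1)) : ℝ) ≤
      f (X k) + lam * (l0 (X k) : ℝ) := fun k => by
    have hmin := hXmin k (X k) (hmem k) subset_rfl
    rw [sub_self, map_zero, kl_self] at hmin
    have hsm := hsmooth _ (hXmem k) _ (hmem k) (hXsupp k)
    have hLα : L ≤ 1 / α := by rwa [le_one_div hL hα0]
    have hkl := mul_le_mul_of_nonneg_right hLα (kl_nonneg (hXmem k) (hmem k) (hXsupp k))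
    linarith
  refine ⟨hdesc, ?_, antitone_eventually_eq (antitone_nat_of_succ_le hXsupp)⟩
  obtain ⟨m, hm⟩ := (isCompact_probSimplex n).bddBelow_image hf.continuous.continuousOn
  refine ⟨_, tendsto_atTop_ciInf (antitone_nat_of_succ_le hdesc) ⟨m, ?_⟩⟩
  rintro _ ⟨k, rfl⟩
  exact le_add_of_le_of_nonneg (hm ⟨X k, hmem k, rfl⟩) (by positivity)
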